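/- arXiv:1810.09974 — 12 statements merged into one kernel-verified Lean document; each statement's English description precedes it below -/
import Mathlib

section
/- Every connected simple graph admits a well-ordered traversal: for every connected simple graph G on a vertex set V there exists a well-order on V every one of whose initial segments induces a connected subgraph of G. -/
/-- `S` is an initial segment (downward-closed set) of the order `r`. -/
def IsInitialSeg {V : Type*} (r : V → V → Prop) (S : Set V) : Prop :=
  ∀ ⦃a b : V⦄, r a b → b ∈ S → a ∈ S

/-- `r` is a traversal of `G`: every nonempty initial segment of `r` induces a
connected subgraph of `G`. -/
def IsTraversal {V : Type*} (G : SimpleGraph V) (r : V → V → Prop) : Prop :=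
  ∀ S : Set V, IsInitialSeg r S → S.Nonempty → (G.induce S).Connected

/-- In a connected graph, every vertex other than `u` has a neighbour closer to `u`. -/
theorem SimpleGraph.Connected.exists_adj_dist_lt {V : Type*} {G : SimpleGraph V}
    (hG : G.Connected) {u v : V} (h : v ≠ u) : ∃ w, G.Adj v w ∧ G.dist w u < G.dist v u := by
  obtain ⟨p, hp⟩ := hG.exists_walk_length_eq_dist v u
  cases p with
  | nil => exact absurd rfl h
  | cons hvw q =>
    refine ⟨_, hvw, ?_⟩
    rw [← hp, SimpleGraph.Walk.length_cons]
    exact Nat.lt_succ_of_le (SimpleGraph.dist_le q)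

/-- A nonempty vertex set closed under decreasing the distance to `u`
induces a connected subgraph. -/
theorem SimpleGraph.Connected.induce_of_dist_closed {V : Type*} {G : SimpleGraph V}
    (hG : G.Connected) (u : V) {S : Set V} (hS : S.Nonempty)
    (hcl : ∀ a b, G.dist a u < G.dist b u → b ∈ S → a ∈ S) : (G.induce S).Connected := by
  have hu : u ∈ S := by
    obtain ⟨x, hx⟩ := hS
    by_cases h : x = u
    · exact h ▸ hx
    · exact hcl u x (by simpa using hG.pos_dist_of_ne h) hx
  have key : ∀ n, ∀ v : S, G.dist v u = n → (G.induce S).Reachable v ⟨u, hu⟩ := by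
    intro n
    induction n using Nat.strong_induction_on with
    | _ n ih =>
      rintro ⟨v, hv⟩ rfl
      by_cases h : v = u
      · subst h
        rfl
      · obtain ⟨w, hvw, hw⟩ := hG.exists_adj_dist_lt h
        have hadj : (G.induce S).Adj ⟨v, hv⟩ ⟨w, hcl w v hw hv⟩ := hvw
        exact hadj.reachable.trans (ih _ hw ⟨w, _⟩ rfl)
  have : Nonempty S := ⟨⟨u, hu⟩⟩
  exact ⟨fun a b => (key _ a rfl).trans (key _ b rfl).symm⟩

/-- Every connected simple graph admits a well-ordered traversal. -/
theorem every_connected_graph_has_wellordered_traversal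
    {V : Type*} (G : SimpleGraph V) (hG : G.Connected) :
    ∃ r : V → V → Prop, IsWellOrder V r ∧ IsTraversal G r := by
  obtain ⟨u⟩ := hG.nonempty
  let f : V ↪ ℕ × V := ⟨fun v => (G.dist v u, v), fun _ _ h => congrArg Prod.snd h⟩
  let s : ℕ × V → ℕ × V → Prop := Prod.Lex (· < ·) WellOrderingRel
  refine ⟨Order.Preimage f s, (RelEmbedding.preimage f s).isWellOrder, fun S hS hne => ?_⟩
  exact hG.induce_of_dist_closed u hne fun a b hab hb => hS (Prod.Lex.left _ _ hab) hb
end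

section
/- For every connected simple graph G on a vertex set V equipped with a well-order <, there exists exactly one well-order ≺ on V satisfying the algorithmic-traversal conditions (i) and (ii), and this ≺ is a well-ordered traversal of G. -/
/-- `m` is the least element of the order `r`. -/
def IsLeastElem {V : Type*} (r : V → V → Prop) (m : V) : Prop :=
  ∀ v : V, v ≠ m → r m v

/-- `prec` is the algorithmic traversal of `(G, lt)` starting at `v₀`:
`prec` is a well-order whose least element is `v₀`, and every other vertex `v`
is the `lt`-least element of the set of vertices outside `I_v = {u | prec u v}`
adjacent to some element of `I_v`. -/
def IsAlgTraversalFrom {V : Type*} (G : SimpleGraph V) (lt prec : V → V → Prop)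
    (v₀ : V) : Prop :=
  IsWellOrder V prec ∧ IsLeastElem prec v₀ ∧
  ∀ v : V, v ≠ v₀ →
    ((∃ u, prec u v ∧ G.Adj u v) ∧
     ∀ w : V, ¬ prec w v → (∃ u, prec u v ∧ G.Adj u w) → w ≠ v → lt v w)

/-- `prec` is the algorithmic traversal of `(G, lt)`: the algorithmic traversal
starting at the `lt`-least vertex. -/
def IsAlgTraversal {V : Type*} (G : SimpleGraph V) (lt prec : V → V → Prop) : Prop :=
  ∃ v₀ : V, IsLeastElem lt v₀ ∧ IsAlgTraversalFrom G lt prec v₀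


/-- Zermelo's construction: iterating an operation `f` that picks a new element outside every
proper subset enumerates the whole type in a well-order. -/
theorem exists_isWellOrder_apply_initialSeg_eq.{u} {V : Type u} (f : Set V → V)
    (hf : ∀ S : Set V, S ≠ Set.univ → f S ∉ S) :
    ∃ r : V → V → Prop, IsWellOrder V r ∧ ∀ v, f {u | r u v} = v := by
  let g : Ordinal.{u} → V :=
    WellFounded.fix (C := fun _ => V) (wellFounded_lt (α := Ordinal.{u}))
      fun o ih => f {v | ∃ a, ∃ h : a < o, ih a h = v}
  have hg : ∀ o, g o = f (g '' Set.Iio o) := by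
    intro o
    have h := WellFounded.fix_eq (C := fun _ => V) (wellFounded_lt (α := Ordinal.{u}))
      (fun o ih => f {v | ∃ a, ∃ h : a < o, ih a h = v}) o
    refine h.trans (congrArg f ?_)
    ext v
    simp [g]
  have hsurj : Function.Surjective g := by
    intro v
    by_contra hv
    have hnew : ∀ a b, a < b → g a ≠ g b := by
      intro a b hab heq
      refine hf (g '' Set.Iio b) (fun hS => ?_) ?_
      · obtain ⟨c, -, hc⟩ : v ∈ g '' Set.Iio b := hS ▸ Set.mem_univ v
        exact hv ⟨c, hc⟩
      · rw [← hg, ← heq]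
        exact ⟨a, hab, rfl⟩
    refine not_injective_of_ordinal g fun a b hab => ?_
    rcases lt_trichotomy a b with h | h | h
    · exact absurd hab (hnew a b h)
    · exact h
    · exact absurd hab.symm (hnew b a h)
  let rank : V → Ordinal.{u} := fun v => sInf {o | g o = v}
  have hrank : ∀ v, g (rank v) = v := fun v => csInf_mem (hsurj v)
  have hinj : Function.Injective rank := Function.LeftInverse.injective hrank
  refine ⟨fun u v => rank u < rank v,
    (RelEmbedding.preimage ⟨rank, hinj⟩ (· < ·)).isWellOrder, fun v => ?_⟩
  have hseg : {u | rank u < rank v} = g '' Set.Iio (rank v) := by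
    ext u
    constructor
    · exact fun hu => ⟨rank u, hu, hrank u⟩
    · rintro ⟨o, ho, rfl⟩
      exact (csInf_le' (show o ∈ {o' | g o' = g o} from rfl)).trans_lt (Set.mem_Iio.1 ho)
  rw [hseg, ← hg, hrank]

/-- Two well-orders in which every element is determined in the same way by the set of its
predecessors coincide. -/
theorem eq_of_apply_initialSeg_eq {V : Type*} (f : Set V → V) {p q : V → V → Prop}
    (hp : IsWellOrder V p) (hq : IsWellOrder V q)
    (hfp : ∀ v, f {u | p u v} = v) (hfq : ∀ v, f {u | q u v} = v) : p = q := by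
  have hseg : ∀ v, {u | p u v} = {u | q u v} := by
    intro v
    induction v using hp.wf.induction with
    | _ v ih =>
      have hne : ({u | p u v}ᶜ : Set V).Nonempty := ⟨v, irrefl_of p v⟩
      obtain ⟨w, hw, hmin⟩ := hq.wf.has_min _ hne
      have hw_eq : {u | p u v} = {u | q u w} := by
        ext u
        constructor
        · intro hu
          rcases trichotomous_of q u w with h | rfl | h
          · exact h
          · exact absurd hu hw
          · have hwu : w ∈ {x | p x u} := by rw [ih u hu]; exact h
            exact absurd (trans_of p hwu hu) hw
        · intro hu
          by_contra h
          exact hmin u h hu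
      have hvw : v = w := by rw [← hfp v, hw_eq, hfq w]
      rw [hw_eq, hvw]
  funext u v
  exact congrFun (hseg v) u

/-- The vertices outside `S` that are adjacent to some vertex of `S`. -/
def outerBoundary {V : Type*} (G : SimpleGraph V) (S : Set V) : Set V :=
  {w | w ∉ S ∧ ∃ u ∈ S, G.Adj u w}

theorem outerBoundary_nonempty {V : Type*} {G : SimpleGraph V} (hG : G.Connected) {S : Set V}
    (hS : S.Nonempty) (hS' : S ≠ Set.univ) : (outerBoundary G S).Nonempty := by
  obtain ⟨u, hu⟩ := hS
  obtain ⟨v, hv⟩ := (Set.ne_univ_iff_exists_notMem S).1 hS'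
  obtain ⟨p⟩ := hG.preconnected u v
  obtain ⟨d, -, h₁, h₂⟩ := p.exists_boundary_dart S hu hv
  exact ⟨d.snd, h₂, d.fst, h₁, d.adj⟩

open Classical in
/-- The vertex visited by graph search once the vertices of `S` have been visited: the least
vertex of the outer boundary of `S`, or the root `v₀` if that boundary is empty. -/
noncomputable def searchNext {V : Type*} (G : SimpleGraph V) {lt : V → V → Prop}
    (wf : WellFounded lt) (v₀ : V) (S : Set V) : V :=
  if h : (outerBoundary G S).Nonempty then wf.min _ h else v₀

section SearchNext

variable {V : Type*} {G : SimpleGraph V} {lt : V → V → Prop}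

theorem searchNext_notMem (hG : G.Connected) (wf : WellFounded lt) (v₀ : V) (S : Set V)
    (hS : S ≠ Set.univ) : searchNext G wf v₀ S ∉ S := by
  rcases S.eq_empty_or_nonempty with rfl | hne
  · exact Set.notMem_empty _
  · have hb := outerBoundary_nonempty hG hne hS
    rw [searchNext, dif_pos hb]
    exact (wf.min_mem _ hb).1

theorem searchNext_empty (wf : WellFounded lt) (v₀ : V) : searchNext G wf v₀ ∅ = v₀ :=
  dif_neg fun ⟨_, _, _, hu, _⟩ => hu

theorem isAlgTraversalFrom_iff (hlt : IsWellOrder V lt) (v₀ : V) (prec : V → V → Prop) :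
    IsAlgTraversalFrom G lt prec v₀ ↔
      IsWellOrder V prec ∧ ∀ v, searchNext G hlt.wf v₀ {u | prec u v} = v := by
  constructor
  · rintro ⟨hwo, hleast, hstep⟩
    refine ⟨hwo, fun v => ?_⟩
    by_cases hv : v = v₀
    · subst hv
      have hempty : {u | prec u v} = ∅ := by
        refine Set.eq_empty_iff_forall_notMem.2 fun u hu => ?_
        by_cases huv : u = v
        · exact irrefl_of prec v (huv ▸ hu)
        · exact asymm_of prec hu (hleast u huv)
      rw [hempty, searchNext_empty]
    · obtain ⟨hadj, hmin⟩ := hstep v hv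
      have hmem : v ∈ outerBoundary G {u | prec u v} := ⟨irrefl_of prec v, hadj⟩
      rw [searchNext, dif_pos ⟨v, hmem⟩]
      by_contra hne
      obtain ⟨h₁, h₂⟩ := hlt.wf.min_mem _ ⟨v, hmem⟩
      exact hlt.wf.not_lt_min _ hmem (hmin _ h₁ h₂ hne)
  · rintro ⟨hwo, hnext⟩
    have hleast : IsLeastElem prec v₀ := by
      obtain ⟨m, -, hm⟩ := hwo.wf.has_min Set.univ ⟨v₀, trivial⟩
      have hempty : {u | prec u m} = ∅ :=
        Set.eq_empty_iff_forall_notMem.2 fun u hu => hm u trivial hu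
      have hm₀ : v₀ = m := by rw [← hnext m, hempty, searchNext_empty]
      intro v hv
      rcases trichotomous_of prec v₀ v with h | h | h
      · exact h
      · exact absurd h.symm hv
      · exact absurd (hm₀ ▸ h) (hm v trivial)
    refine ⟨hwo, hleast, fun v hv => ?_⟩
    have hb : (outerBoundary G {u | prec u v}).Nonempty := by
      by_contra hb
      have h := hnext v
      rw [searchNext, dif_neg hb] at h
      exact hv h.symm
    have hmin : hlt.wf.min _ hb = v := by
      have h := hnext v
      rwa [searchNext, dif_pos hb] at h
    refine ⟨?_, fun w hw hadj hwv => ?_⟩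
    · have hmem := (hlt.wf.min_mem _ hb).2
      rwa [hmin] at hmem
    · have hnot : ¬ lt w v := by
        have h := hlt.wf.not_lt_min _ (show w ∈ outerBoundary G {u | prec u v} from ⟨hw, hadj⟩)
        rwa [hmin] at h
      rcases trichotomous_of lt v w with h | h | h
      · exact h
      · exact absurd h.symm hwv
      · exact absurd h hnot

theorem IsAlgTraversalFrom.isTraversal {prec : V → V → Prop} {v₀ : V}
    (h : IsAlgTraversalFrom G lt prec v₀) : IsTraversal G prec := by
  obtain ⟨hwo, hleast, hstep⟩ := h
  rintro S hS ⟨s, hs⟩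
  have hv₀ : v₀ ∈ S := by
    by_cases hsv : s = v₀
    · exact hsv ▸ hs
    · exact hS (hleast s hsv) hs
  have hreach : ∀ v (hv : v ∈ S), (G.induce S).Reachable ⟨v₀, hv₀⟩ ⟨v, hv⟩ := by
    intro v
    induction v using hwo.wf.induction with
    | _ v ih =>
      intro hv
      by_cases hvv : v = v₀
      · subst hvv
        exact SimpleGraph.Reachable.refl _
      · obtain ⟨⟨u, huv, hadj⟩, -⟩ := hstep v hvv
        have hu : u ∈ S := hS huv hv
        have hadj' : (G.induce S).Adj ⟨u, hu⟩ ⟨v, hv⟩ := hadj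
        exact (ih u huv hu).trans hadj'.reachable
  have : Nonempty S := ⟨⟨v₀, hv₀⟩⟩
  exact ⟨fun a b => (hreach a a.2).symm.trans (hreach b b.2)⟩

end SearchNext

/-- For every connected simple graph equipped with a well-order there is exactly one
algorithmic traversal, and it is a well-ordered traversal. -/
theorem algTraversal_existsUnique_and_isTraversal
    {V : Type*} (G : SimpleGraph V) (hG : G.Connected)
    (lt : V → V → Prop) (hlt : IsWellOrder V lt) :
    (∃! prec : V → V → Prop, IsAlgTraversal G lt prec) ∧
    (∀ prec : V → V → Prop, IsAlgTraversal G lt prec → IsTraversal G prec) := by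
  refine ⟨?_, fun prec ⟨_, _, h⟩ => h.isTraversal⟩
  obtain ⟨v₀, -, hmin⟩ := hlt.wf.has_min Set.univ ⟨hG.nonempty.some, trivial⟩
  have hv₀ : IsLeastElem lt v₀ := by
    intro v hv
    rcases trichotomous_of lt v₀ v with h | h | h
    · exact h
    · exact absurd h.symm hv
    · exact absurd h (hmin v trivial)
  obtain ⟨r, hr, hfr⟩ := exists_isWellOrder_apply_initialSeg_eq (searchNext G hlt.wf v₀)
    (searchNext_notMem hG hlt.wf v₀)
  refine ⟨r, ⟨v₀, hv₀, (isAlgTraversalFrom_iff hlt v₀ r).2 ⟨hr, hfr⟩⟩, ?_⟩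
  rintro p ⟨v₁, hv₁, hp⟩
  have hv : v₁ = v₀ := by
    by_contra hne
    exact hmin v₁ trivial (hv₁ v₀ (Ne.symm hne))
  subst hv
  obtain ⟨hpw, hfp⟩ := (isAlgTraversalFrom_iff hlt v₁ p).1 hp
  exact eq_of_apply_initialSeg_eq _ hpw hr hfp hfr
end

section
/- Let (V,E,<) be a connected simple graph equipped with a well-order <. If < is itself a traversal of (V,E), then the algorithmic traversal of ((V,E),<) is equal to <. -/
/-- In a traversal with least element `v₀`, every other vertex has a smaller neighbour. -/
theorem IsTraversal.exists_adj_lt {V : Type*} {G : SimpleGraph V} {r : V → V → Prop}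
    [IsTrans V r] (h : IsTraversal G r) {v₀ w : V} (hv₀ : IsLeastElem r v₀) (hw : w ≠ v₀) :
    ∃ u, r u w ∧ G.Adj u w := by
  have hS : IsInitialSeg r {u | r u w ∨ u = w} := by
    rintro a b hab (hb | rfl)
    · exact Or.inl (_root_.trans hab hb)
    · exact Or.inl hab
  obtain ⟨p⟩ := (h _ hS ⟨w, Or.inr rfl⟩).preconnected
    ⟨w, Or.inr rfl⟩ ⟨v₀, Or.inl (hv₀ w hw)⟩
  cases p with
  | nil => exact absurd rfl hw
  | @cons _ u _ hadj _ =>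
    have hadj' : G.Adj w u := hadj
    exact ⟨u, u.2.resolve_right hadj'.ne', hadj'.symm⟩

/-- If the input well-order is itself a traversal, then the algorithmic traversal
coincides with it. -/
theorem algTraversal_fixes_traversals
    {V : Type*} (G : SimpleGraph V) (hG : G.Connected)
    (lt : V → V → Prop) (hlt : IsWellOrder V lt) (htrav : IsTraversal G lt)
    (prec : V → V → Prop) (halg : IsAlgTraversal G lt prec) :
    prec = lt := by
  obtain ⟨v₀, hv₀, hprec, hleast, hstep⟩ := halg
  have key : ∀ v x, prec v x → lt v x := by
    intro v x hvx
    have hxv : x ≠ v := by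
      rintro rfl
      exact irrefl_of prec _ hvx
    by_cases hv : v = v₀
    · subst hv
      exact hv₀ x hxv
    obtain ⟨w, hw, hmin⟩ := hlt.wf.has_min {u | ¬ prec u v} ⟨v, irrefl_of prec v⟩
    have hw₀ : w ≠ v₀ := by
      rintro rfl
      exact hw (hleast v hv)
    obtain ⟨u, hu, hadj⟩ := htrav.exists_adj_lt hv₀ hw₀
    have huv : prec u v := by
      by_contra hn
      exact hmin u hn hu
    have hwv : w = v := by
      by_contra hne
      exact hmin v (irrefl_of prec v) ((hstep v hv).2 w hw ⟨u, huv, hadj⟩ hne)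
    subst hwv
    have hx := hmin x (asymm_of prec hvx)
    rcases trichotomous_of lt w x with h | h | h
    · exact h
    · exact absurd h.symm hxv
    · exact absurd h hx
  funext a b
  refine propext ⟨key a b, fun hab => ?_⟩
  rcases trichotomous_of prec a b with h | h | h
  · exact h
  · subst h
    exact absurd hab (irrefl_of lt a)
  · exact absurd (key b a h) (asymm_of lt hab)
end

section
/- Let (V,E,<) be a connected simple graph equipped with a well-order < whose order type is a cardinal κ (an initial ordinal). Then the algorithmic traversal of ((V,E),<) also has order type κ. -/
/-- In an algorithmic traversal, if `v` is adjacent to an earlier vertex `u`, then every vertex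
visited strictly between `u` and `v` is `lt`-smaller than `v`. -/
theorem IsAlgTraversalFrom.lt_of_prec_of_prec {V : Type*} {G : SimpleGraph V}
    {lt prec : V → V → Prop} {v₀ u v w : V} (h : IsAlgTraversalFrom G lt prec v₀)
    (huv : G.Adj u v) (huw : prec u w) (hwv : prec w v) : lt w v := by
  obtain ⟨hwo, hleast, hstep⟩ := h
  have hw : w ≠ v₀ := by
    rintro rfl
    by_cases huw' : u = w
    · subst huw'
      exact irrefl_of prec u huw
    · exact asymm_of prec huw (hleast u huw')
  refine (hstep w hw).2 v (asymm_of prec hwv) ⟨u, huw, huv⟩ ?_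
  rintro rfl
  exact irrefl_of prec _ hwv

/-- If all proper initial segments of `lt` have cardinality below the infinite cardinal `c`, then
so do all proper initial segments of the algorithmic traversal. -/
theorem IsAlgTraversalFrom.mk_prec_lt {V : Type*} {G : SimpleGraph V}
    {lt prec : V → V → Prop} {v₀ : V} (h : IsAlgTraversalFrom G lt prec v₀)
    {c : Cardinal} (hc : Cardinal.aleph0 ≤ c)
    (hlt : ∀ v, Cardinal.mk {w | lt w v} < c) (v : V) :
    Cardinal.mk {w | prec w v} < c := by
  have hwo : IsWellOrder V prec := h.1
  induction v using hwo.wf.induction with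
  | _ v ih =>
  by_cases hv : v = v₀
  · subst hv
    have hempty : {w | prec w v} = ∅ := by
      refine Set.eq_empty_of_forall_notMem fun w hw => ?_
      by_cases hwv : w = v
      · subst hwv
        exact irrefl_of prec w hw
      · exact asymm_of prec hw (h.2.1 w hwv)
    rw [hempty, Cardinal.mk_eq_zero]
    exact Cardinal.aleph0_pos.trans_le hc
  · obtain ⟨u, huv, hadj⟩ := (h.2.2 v hv).1
    have hsub : {w | prec w v} ⊆ {w | prec w u} ∪ ({u} ∪ {w | lt w v}) := by
      intro w hw
      rcases trichotomous_of prec w u with hwu | rfl | huw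
      · exact Or.inl hwu
      · exact Or.inr (Or.inl rfl)
      · exact Or.inr (Or.inr (h.lt_of_prec_of_prec hadj huw hw))
    refine (Cardinal.mk_le_mk_of_subset hsub).trans_lt ((Cardinal.mk_union_le _ _).trans_lt ?_)
    refine Cardinal.add_lt_of_lt hc (ih u huv) ((Cardinal.mk_union_le _ _).trans_lt ?_)
    refine Cardinal.add_lt_of_lt hc ?_ (hlt v)
    rw [Cardinal.mk_singleton]
    exact Cardinal.one_lt_aleph0.trans_le hc

/-- If the order type of the input well-order is a cardinal (an initial ordinal),
then the algorithmic traversal has the same order type. -/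
theorem algTraversal_type_eq_of_type_is_cardinal
    {V : Type*} (G : SimpleGraph V) (hG : G.Connected)
    (lt : V → V → Prop) (hlt : IsWellOrder V lt)
    (hcard : (@Ordinal.type V lt hlt).card.ord = @Ordinal.type V lt hlt)
    (prec : V → V → Prop) (halg : IsAlgTraversal G lt prec)
    (hprec : IsWellOrder V prec) :
    @Ordinal.type V prec hprec = @Ordinal.type V lt hlt := by
  obtain ⟨v₀, -, h⟩ := halg
  have hord : (Cardinal.mk V).ord = Ordinal.type lt := by
    rw [← hcard, Ordinal.card_type]
  rcases lt_or_ge (Cardinal.mk V) Cardinal.aleph0 with hfin | hinf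
  · obtain ⟨n, hn⟩ := Cardinal.lt_aleph0.1 hfin
    have key : ∀ (r : V → V → Prop) [IsWellOrder V r], Ordinal.type r = n := fun r _ =>
      Ordinal.card_eq_nat.1 ((Ordinal.card_type r).trans hn)
    rw [key lt, key prec]
  · refine le_antisymm ?_ (hord ▸ Cardinal.ord_le_type prec)
    rw [← hord]
    have hsmall : ∀ v, Cardinal.mk {w | lt w v} < Cardinal.mk V := by
      intro v
      have hv := Ordinal.typein_lt_type lt v
      rw [← hord, Cardinal.lt_ord] at hv
      exact hv
    refine le_of_forall_lt fun o ho => ?_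
    obtain ⟨v, rfl⟩ := Ordinal.typein_surj prec ho
    rw [Cardinal.lt_ord]
    exact h.mk_prec_lt hinf hsmall v
end

section
/- Let (V,E) be a connected simple graph and < a well-order on V. Then < is a traversal of (V,E) if and only if every vertex other than the <-least vertex has a neighbor strictly <-smaller than itself. -/
/-- A well-order on the vertices of a connected graph is a traversal iff every vertex
other than the least one has a strictly smaller neighbor. -/
theorem isTraversal_iff_lesser_neighbor
    {V : Type*} (G : SimpleGraph V) (hG : G.Connected)
    (lt : V → V → Prop) (hlt : IsWellOrder V lt) :
    IsTraversal G lt ↔ ∀ v : V, (∃ u, lt u v) → ∃ u, lt u v ∧ G.Adj u v := by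
  constructor
  · rintro h v ⟨u, huv⟩
    have hc := h {w | w = v ∨ lt w v}
      (by
        rintro a b hab (rfl | hb)
        · exact Or.inr hab
        · exact Or.inr (_root_.trans hab hb))
      ⟨v, Or.inl rfl⟩
    obtain ⟨p⟩ := hc.preconnected ⟨v, Or.inl rfl⟩ ⟨u, Or.inr huv⟩
    cases p with
    | nil => exact absurd huv (irrefl v)
    | @cons _ w _ hvw _ =>
      have hadj : G.Adj v w := hvw
      rcases w.2 with hw | hw
      · exact absurd hw.symm hadj.ne
      · exact ⟨w, hw, hadj.symm⟩
  · intro h S hS hne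
    have hwf : WellFounded lt := hlt.wf
    obtain ⟨m, hm, hmin⟩ := hwf.has_min S hne
    rw [SimpleGraph.connected_iff_exists_forall_reachable]
    refine ⟨⟨m, hm⟩, ?_⟩
    rintro ⟨w, hw⟩
    induction w using hwf.induction with
    | _ w ih =>
      rcases trichotomous_of lt m w with hmw | rfl | hwm
      · obtain ⟨u, huw, hadj⟩ := h w ⟨m, hmw⟩
        have hu : u ∈ S := hS huw hw
        have hadj' : (G.induce S).Adj ⟨u, hu⟩ ⟨w, hw⟩ := hadj
        exact (ih u huw hu).trans hadj'.reachable
      · rfl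
      · exact absurd hwm (hmin w hw)
end

section
/- Let < be a well-ordered traversal of a connected simple graph (V,E), and let p be the least neighbor function of <. Then the graph on V whose edge set is E† = { {v, p(v)} : v ∈ V, v not the <-least vertex } is a spanning tree of (V,E): it is a connected, acyclic subgraph of (V,E) on the full vertex set V. -/
/-- `m` is the `r`-least neighbor of `v` in `G`. -/
def IsLeastNeighbor {V : Type*} (G : SimpleGraph V) (r : V → V → Prop)
    (v m : V) : Prop :=
  G.Adj v m ∧ ∀ w : V, G.Adj v w → ¬ r w m

namespace SimpleGraph

/-- A graph on a linear order in which every vertex has at most one smaller neighbor is acyclic. -/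
theorem isAcyclic_of_lt_neighbor_unique {V : Type*} [LinearOrder V] (H : SimpleGraph V)
    (h : ∀ v a b : V, H.Adj v a → H.Adj v b → a < v → b < v → a = b) : H.IsAcyclic := by
  intro u c hc
  obtain ⟨m, hm, hmax⟩ := c.support.toFinset.exists_max_image id ⟨u, by simp⟩
  simp only [List.mem_toFinset, id] at hm hmax
  have hc' := hc.rotate hm
  have hle : ∀ x ∈ (c.rotate m hm).support, x ≤ m := fun x hx ↦
    hmax x ((c.mem_support_rotate_iff _ hm).1 hx)
  have hs := (c.rotate m hm).adj_snd hc'.not_nil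
  have ht := ((c.rotate m hm).adj_penultimate hc'.not_nil).symm
  exact hc'.snd_ne_penultimate <| h m _ _ hs ht
    (lt_of_le_of_ne (hle _ (Walk.getVert_mem_support _ _)) hs.ne')
    (lt_of_le_of_ne (hle _ (Walk.getVert_mem_support _ _)) ht.ne')

end SimpleGraph

/-- In a traversal, every vertex other than the least one has a smaller neighbor. -/
theorem IsTraversal.exists_adj_lt_s6 {V : Type*} {G : SimpleGraph V} {lt : V → V → Prop}
    [IsStrictTotalOrder V lt] (htrav : IsTraversal G lt) {u v : V} (huv : lt u v) :
    ∃ w, G.Adj v w ∧ lt w v := by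
  have hS : IsInitialSeg lt {w | w = v ∨ lt w v} := by
    rintro a b hab (rfl | hb)
    · exact Or.inr hab
    · exact Or.inr (_root_.trans hab hb)
  have hne : u ≠ v := fun h ↦ irrefl v (h ▸ huv)
  obtain ⟨⟨w, hw⟩, hadj⟩ := SimpleGraph.Reachable.nonempty_neighborSet_left
    (u := ⟨v, Or.inl rfl⟩) (v := ⟨u, Or.inr huv⟩) (fun h ↦ hne (congrArg Subtype.val h).symm)
    ((htrav _ hS ⟨v, Or.inl rfl⟩).preconnected _ _)
  have hvw : G.Adj v w := hadj
  exact ⟨w, hvw, hw.resolve_left hvw.ne'⟩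

/-- Given a well-ordered traversal `lt` of a connected graph `G` with least neighbor
function `p`, the symmetrization of the graph of `p` (on non-least vertices) is a
spanning tree of `G`. -/
theorem traversal_tree
    {V : Type*} (G : SimpleGraph V) (hG : G.Connected)
    (lt : V → V → Prop) (hlt : IsWellOrder V lt) (htrav : IsTraversal G lt)
    (p : V → V) (hp : ∀ v : V, (∃ u, lt u v) → IsLeastNeighbor G lt v (p v)) :
    (SimpleGraph.fromRel (fun a b => (∃ u, lt u a) ∧ b = p a)).IsTree ∧
    SimpleGraph.fromRel (fun a b => (∃ u, lt u a) ∧ b = p a) ≤ G := by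
  classical
  let : LinearOrder V := linearOrderOfSTO lt
  have hwf : WellFounded lt := hlt.wf
  set T := SimpleGraph.fromRel (fun a b => (∃ u, lt u a) ∧ b = p a)
  have hplt : ∀ v, (∃ u, lt u v) → p v < v := by
    rintro v ⟨u, huv⟩
    obtain ⟨w, hvw, hwv⟩ := htrav.exists_adj_lt_s6 huv
    exact (not_lt.1 ((hp v ⟨u, huv⟩).2 w hvw)).trans_lt hwv
  have hTadj : ∀ v, (∃ u, lt u v) → T.Adj v (p v) := fun v hv ↦
    (SimpleGraph.fromRel_adj _ _ _).2 ⟨(hplt v hv).ne', Or.inl ⟨hv, rfl⟩⟩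
  obtain ⟨v₀⟩ := hG.nonempty
  let m := hwf.min Set.univ ⟨v₀, trivial⟩
  have hreach : ∀ v, T.Reachable m v := by
    intro v
    induction v using hwf.induction with
    | _ v ih =>
      by_cases hv : ∃ u, lt u v
      · exact (ih _ (hplt v hv)).trans (hTadj v hv).symm.reachable
      · have hmv : m = v := le_antisymm
          (not_lt.1 (hwf.not_lt_min Set.univ trivial)) (not_lt.1 fun h ↦ hv ⟨m, h⟩)
        exact hmv ▸ .rfl
  have heq : ∀ v a, T.Adj v a → a < v → a = p v := by
    intro v a hva hlt'
    obtain ⟨-, ⟨-, h⟩ | ⟨ha, h⟩⟩ := (SimpleGraph.fromRel_adj _ _ _).1 hva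
    · exact h
    · exact absurd (h ▸ hplt a ha) hlt'.not_gt
  refine ⟨⟨SimpleGraph.connected_iff_exists_forall_reachable _ |>.2 ⟨m, hreach⟩,
    T.isAcyclic_of_lt_neighbor_unique fun v a b ha hb hav hbv ↦
      (heq v a ha hav).trans (heq v b hb hbv).symm⟩, ?_⟩
  intro a b hab
  obtain ⟨-, ⟨ha, rfl⟩ | ⟨hb, rfl⟩⟩ := (SimpleGraph.fromRel_adj _ _ _).1 hab
  · exact (hp a ha).1
  · exact (hp b hb).1.symm
end

section
/- Let ≺ be the algorithmic traversal of a connected simple graph (V,E) equipped with a well-order <, let p* be the least neighbor function of ≺ (so p*(v) is the ≺-least neighbor of v for v not ≺-least), and let E* = { {v, p*(v)} : v ∈ V, v not the ≺-least vertex }. Then (V,E*) is connected, and the algorithmic traversal of ((V,E*),<) is equal to ≺. -/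
/-- Let `prec` be the algorithmic traversal of `(G, lt)` and `p` its least neighbor
function. Then the search tree `E* = {{v, p v} : v not prec-least}` is connected, and
the algorithmic traversal of `(E*, lt)` is again `prec`. -/
theorem search_tree_search
    {V : Type*} (G : SimpleGraph V) (hG : G.Connected)
    (lt : V → V → Prop) (hlt : IsWellOrder V lt)
    (prec : V → V → Prop) (halg : IsAlgTraversal G lt prec)
    (p : V → V) (hp : ∀ v : V, (∃ u, prec u v) → IsLeastNeighbor G prec v (p v)) :
    (SimpleGraph.fromRel (fun a b => (∃ u, prec u a) ∧ b = p a)).Connected ∧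
    IsAlgTraversal (SimpleGraph.fromRel (fun a b => (∃ u, prec u a) ∧ b = p a)) lt prec := by
  obtain ⟨v₀, hv₀, hwo, hleast, hstep⟩ := halg
  have hpred : ∀ v, v ≠ v₀ → prec (p v) v := by
    intro v hv
    obtain ⟨u, huv, hadj⟩ := (hstep v hv).1
    rcases trichotomous_of prec (p v) u with h | h | h
    · exact _root_.trans h huv
    · exact h ▸ huv
    · exact absurd h ((hp v ⟨u, huv⟩).2 u hadj.symm)
  have hle : SimpleGraph.fromRel (fun a b => (∃ u, prec u a) ∧ b = p a) ≤ G := by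
    rintro a b ⟨-, ⟨ha, rfl⟩ | ⟨hb, rfl⟩⟩
    · exact (hp a ha).1
    · exact (hp b hb).1.symm
  have hadj : ∀ v, v ≠ v₀ →
      (SimpleGraph.fromRel (fun a b => (∃ u, prec u a) ∧ b = p a)).Adj (p v) v := by
    intro v hv
    have hex : ∃ u, prec u v := ⟨v₀, hleast v hv⟩
    exact ⟨(hp v hex).1.ne', Or.inr ⟨hex, rfl⟩⟩
  refine ⟨?_, v₀, hv₀, hwo, hleast, fun v hv =>
    ⟨⟨p v, hpred v hv, hadj v hv⟩, fun w hw ⟨u, huv, huw⟩ =>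
      (hstep v hv).2 w hw ⟨u, huv, hle huw⟩⟩⟩
  refine (SimpleGraph.connected_iff_exists_forall_reachable _).2 ⟨v₀, fun v => ?_⟩
  induction v using hwo.wf.induction with
  | _ v ih =>
    by_cases hv : v = v₀
    · exact hv ▸ SimpleGraph.Reachable.refl _
    · exact (ih _ (hpred v hv)).trans (hadj v hv).reachable
end

section
/- Let ≺ be the algorithmic traversal of a connected simple graph (V,E) equipped with a well-order <, and let p* be the least neighbor function of ≺. Suppose W ⊆ V is nonempty with ≺-least element w₀, and W is closed under p* except possibly at w₀: for every w ∈ W with w ≠ w₀ and w not the ≺-least element of V, p*(w) ∈ W. Then W induces a connected subgraph of (V,E), and the algorithmic traversal starting at w₀ of the induced ordered subgraph (W, E restricted to W, < restricted to W) agrees with the restriction of ≺ to W. -/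
/-- Stability of algorithmic traversals under subsets closed under the traversal
least neighbor function: such a subset `W` induces a connected subgraph, and the
restriction of the algorithmic traversal `prec` to `W` is precisely the algorithmic
traversal, starting at the `prec`-least element `w₀` of `W`, of the induced ordered
subgraph. -/
theorem subsets_stable_under_traversals
    {V : Type*} (G : SimpleGraph V) (hG : G.Connected)
    (lt : V → V → Prop) (hlt : IsWellOrder V lt)
    (prec : V → V → Prop) (halg : IsAlgTraversal G lt prec)
    (p : V → V) (hp : ∀ v : V, (∃ u, prec u v) → IsLeastNeighbor G prec v (p v))
    (W : Set V) (w₀ : V) (hw₀ : w₀ ∈ W)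
    (hleast : ∀ w ∈ W, w ≠ w₀ → prec w₀ w)
    (hclosed : ∀ w ∈ W, w ≠ w₀ → (∃ u, prec u w) → p w ∈ W) :
    (G.induce W).Connected ∧
    IsAlgTraversalFrom (G.induce W) (fun a b : W => lt a b) (fun a b : W => prec a b)
      ⟨w₀, hw₀⟩ := by
  obtain ⟨v₀, -, hwo, hmin, hstep⟩ := halg
  have ne_of_prec {a b : V} (h : prec a b) : b ≠ v₀ := by
    rintro rfl
    have hab : a ≠ b := fun e => irrefl_of prec a (e ▸ h)
    exact asymm_of prec h (hmin a hab)
  have parent (w : V) (hw : w ∈ W) (hne : w ≠ w₀) :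
      p w ∈ W ∧ prec (p w) w ∧ G.Adj (p w) w := by
    have hlt₀ := hleast w hw hne
    obtain ⟨hadj, hpmin⟩ := hp w ⟨w₀, hlt₀⟩
    obtain ⟨u, huw, hau⟩ := (hstep w (ne_of_prec hlt₀)).1
    refine ⟨hclosed w hw hne ⟨w₀, hlt₀⟩, ?_, hadj.symm⟩
    rcases trichotomous_of prec (p w) u with h | h | h
    · exact trans_of prec h huw
    · exact h ▸ huw
    · exact absurd h (hpmin u hau.symm)
  have reach (w : V) : ∀ hw : w ∈ W, (G.induce W).Reachable ⟨w₀, hw₀⟩ ⟨w, hw⟩ := by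
    induction w using hwo.wf.induction with
    | _ w ih =>
      intro hw
      by_cases hne : w = w₀
      · subst hne
        exact .refl _
      · obtain ⟨hpW, hpw, hadj⟩ := parent w hw hne
        have hadj' : (G.induce W).Adj ⟨p w, hpW⟩ ⟨w, hw⟩ := hadj
        exact (ih (p w) hpw hpW).trans hadj'.reachable
  refine ⟨(SimpleGraph.connected_iff_exists_forall_reachable _).2
      ⟨⟨w₀, hw₀⟩, fun w => reach w w.2⟩,
    (Subrel.relEmbedding prec (· ∈ W)).isWellOrder,
    fun v hv => hleast v v.2 fun e => hv (Subtype.ext e), fun v hv => ?_⟩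
  have hne : (v : V) ≠ w₀ := fun e => hv (Subtype.ext e)
  obtain ⟨hpW, hpv, hadj⟩ := parent v v.2 hne
  refine ⟨⟨⟨p v, hpW⟩, hpv, hadj⟩, ?_⟩
  rintro w hwv ⟨u, huv, huw⟩ hwne
  exact (hstep v (ne_of_prec (hleast v v.2 hne))).2 w hwv ⟨u, huv, huw⟩
    fun e => hwne (Subtype.ext e)
end

section
/- Let V be a set carrying a linear order < and a well-order ≺. For every subset C of V that is cofinal in (V,<), there exists a subset C* ⊆ C that is cofinal in (V,<) and on which the two orders agree: for all c₁, c₂ ∈ C*, c₁ < c₂ if and only if c₁ ≺ c₂. -/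
/-- `C` is cofinal in the strict order `r`: every element is `≤` some element of `C`. -/
def IsCofinalIn {V : Type*} (r : V → V → Prop) (C : Set V) : Prop :=
  ∀ v : V, ∃ c ∈ C, v = c ∨ r v c

/-- Given a linear order `lt` and a well-order `prec` on the same set, any `lt`-cofinal
set `C` contains an `lt`-cofinal subset `C*` on which the two orders agree. -/
theorem ordered_subcofinality
    {V : Type*} (lt : V → V → Prop) (hlt : IsStrictTotalOrder V lt)
    (prec : V → V → Prop) (hprec : IsWellOrder V prec)
    (C : Set V) (hC : IsCofinalIn lt C) :
    ∃ Cstar : Set V, Cstar ⊆ C ∧ IsCofinalIn lt Cstar ∧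
      ∀ c₁ ∈ Cstar, ∀ c₂ ∈ Cstar, (lt c₁ c₂ ↔ prec c₁ c₂) := by
  refine ⟨{c ∈ C | ∀ d ∈ C, prec d c → lt d c}, fun c hc => hc.1, fun v => ?_,
    fun c₁ h₁ c₂ h₂ => ⟨fun h => ?_, h₂.2 c₁ h₁.1⟩⟩
  · obtain ⟨c, ⟨hcC, hvc⟩, hmin⟩ :=
      hprec.wf.has_min {c | c ∈ C ∧ (v = c ∨ lt v c)} (hC v)
    refine ⟨c, ⟨hcC, fun d hd hdc => ?_⟩, hvc⟩
    have hvd : ¬(v = d ∨ lt v d) := fun hvd => hmin d ⟨hd, hvd⟩ hdc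
    have hdv : lt d v := by
      rcases trichotomous_of lt d v with h | h | h
      · exact h
      · exact absurd (Or.inl h.symm) hvd
      · exact absurd (Or.inr h) hvd
    rcases hvc with rfl | hvc
    · exact hdv
    · exact trans_of lt hdv hvc
  · rcases trichotomous_of prec c₁ c₂ with h' | rfl | h'
    · exact h'
    · exact absurd h (irrefl_of lt c₁)
    · exact absurd (h₁.2 c₂ h₂.1 h') (asymm_of lt h)
end

section
/- Let (V,E,<) be a connected simple graph equipped with a well-order <, and let ≺ be the algorithmic traversal of ((V,E),<). Then ≺ is lexicographically least among all well-ordered traversals of (V,E): for every well-ordered traversal R of (V,E) with R ≠ ≺, the order ≺ is lexicographically less than R with respect to <. -/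
/-- `R` is lexicographically less than `R'` with respect to the order `lt`:
identifying a well-order with its enumeration, there is a position (ordinal) `γ`
at which the enumerations first differ, and there the value of `R` is `lt`-below
that of `R'`.  Concretely: there are `a b` with `lt a b` such that `a` and `b`
have the same set of strict predecessors `{u | R u a} = {u | R' u b}`, on which
`R` and `R'` agree (hence the enumerations of `R` and `R'` coincide up to some
ordinal `γ`, `a` is the `γ`-th element of `R`, and `b` is the `γ`-th element of
`R'`). -/
def LexLess {V : Type*} (lt R R' : V → V → Prop) : Prop :=
  ∃ a b : V, lt a b ∧ {u | R u a} = {u | R' u b} ∧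
    ∀ u v : V, R u a → R v a → (R u v ↔ R' u v)

/-- In a traversal, every vertex with a strict predecessor is adjacent to one of its strict
predecessors. -/
theorem IsTraversal.exists_adj_pred {V : Type*} {G : SimpleGraph V} {r : V → V → Prop}
    [IsTrans V r] (h : IsTraversal G r) {b c : V} (hcb : r c b) (hne : c ≠ b) :
    ∃ u, r u b ∧ G.Adj u b := by
  have hseg : IsInitialSeg r {u | r u b ∨ u = b} := by
    rintro x y hxy (hy | rfl)
    · exact Or.inl (_root_.trans hxy hy)
    · exact Or.inl hxy
  have hconn := h _ hseg ⟨b, Or.inr rfl⟩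
  obtain ⟨p⟩ := hconn.preconnected ⟨b, Or.inr rfl⟩ ⟨c, Or.inl hcb⟩
  cases p with
  | nil => exact absurd rfl hne
  | @cons _ w _ hadj _ =>
    have hadj' : G.Adj b w := hadj
    obtain hw | hw := w.2
    · exact ⟨w, hw, hadj'.symm⟩
    · exact absurd hw.symm hadj'.ne

/-- If two well-orders differ, then there are `a ≠ b` with the same strict predecessors,
on which the two orders agree. -/
theorem exists_first_difference {V : Type*} {r s : V → V → Prop} [IsWellOrder V r]
    [IsWellOrder V s] (hne : s ≠ r) :
    ∃ a b : V, a ≠ b ∧ {u | r u a} = {u | s u b} ∧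
      ∀ u v : V, r u a → r v a → (r u v ↔ s u v) := by
  have hex : {v | ¬ ∀ u, r u v ↔ s u v}.Nonempty := by
    by_contra hempty
    refine hne (funext₂ fun u v => propext ?_)
    by_contra huv
    exact hempty ⟨v, fun hv => huv (hv u).symm⟩
  obtain ⟨a, ha, hamin⟩ := (IsWellFounded.wf : WellFounded r).has_min _ hex
  have hagree : ∀ v, r v a → ∀ u, r u v ↔ s u v := fun v hv =>
    not_not.mp fun hn => hamin v hn hv
  obtain ⟨b, hb, hbmin⟩ := (IsWellFounded.wf : WellFounded s).has_min {v | ¬ r v a}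
    ⟨a, irrefl a⟩
  have hseg : {u | r u a} = {u | s u b} := by
    ext u
    refine ⟨fun hu => ?_, fun hu => not_not.mp fun hn => hbmin u hn hu⟩
    rcases trichotomous_of s u b with hub | rfl | hbu
    · exact hub
    · exact absurd hu hb
    · exact absurd (_root_.trans ((hagree u hu b).mpr hbu) hu) hb
  refine ⟨a, b, ?_, hseg, fun u v _ hv => hagree v hv u⟩
  rintro rfl
  exact ha fun u => Set.ext_iff.mp hseg u

/-- The algorithmic traversal is lexicographically least among all well-ordered
traversals of the graph. -/
theorem algTraversal_lex_minimal
    {V : Type*} (G : SimpleGraph V) (hG : G.Connected)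
    (lt : V → V → Prop) (hlt : IsWellOrder V lt)
    (prec : V → V → Prop) (halg : IsAlgTraversal G lt prec)
    (R : V → V → Prop) (hR : IsWellOrder V R) (hRtrav : IsTraversal G R)
    (hne : R ≠ prec) :
    LexLess lt prec R := by
  obtain ⟨v₀, hv₀, hwo, hleast, hstep⟩ := halg
  obtain ⟨a, b, hab, hseg, hagree⟩ := exists_first_difference hne
  refine ⟨a, b, ?_, hseg, hagree⟩
  by_cases ha : a = v₀
  · exact ha ▸ hv₀ b (ha ▸ hab.symm)
  · have hmem : ∀ u, prec u a ↔ R u b := Set.ext_iff.mp hseg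
    have hRv₀ : R v₀ b := (hmem v₀).mp (hleast a ha)
    obtain ⟨u, hub, hadj⟩ := hRtrav.exists_adj_pred hRv₀ (ne_of_irrefl hRv₀)
    exact (hstep a ha).2 b (fun h => irrefl b ((hmem b).mp h))
      ⟨u, (hmem u).mpr hub, hadj⟩ hab.symm
end

section
/- Let (V,E) be a connected acyclic simple graph (a tree), let ≺ be a well-ordered breadth-first traversal of (V,E) whose ≺-least element is v₀, let p be the least neighbor function of ≺, and for each n < ω let L_n be the set of vertices at graph distance n from v₀. Then for every n < ω: (1) p maps L_{n+1} into L_n; (2) L_n is an interval of (V,≺); and (3) every element of L_n strictly ≺-precedes every element of L_{n+1}. -/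
theorem SimpleGraph.IsAcyclic.dist_eq_length_of_isPath {V : Type*} {G : SimpleGraph V}
    (hacyc : G.IsAcyclic) {u v : V} {q : G.Walk u v} (hq : q.IsPath) :
    G.dist u v = q.length := by
  obtain ⟨r, hr, hlen⟩ := q.reachable.exists_path_of_dist
  have : (⟨r, hr⟩ : G.Path u v) = ⟨q, hq⟩ := (hacyc.subsingleton_path u v).elim _ _
  rw [← hlen, show r = q from congrArg Subtype.val this]

/-- In a traversal, every vertex other than the least one is preceded by one of its neighbors. -/
theorem IsTraversal.exists_adj_prec {V : Type*} {G : SimpleGraph V} {r : V → V → Prop}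
    [IsTrans V r] (htrav : IsTraversal G r) {m v : V} (hm : IsLeastElem r m) (hv : v ≠ m) :
    ∃ u, G.Adj v u ∧ r u v := by
  have hS : IsInitialSeg r {u | u = v ∨ r u v} := by
    rintro a b hab (rfl | hb)
    · exact Or.inr hab
    · exact Or.inr (_root_.trans hab hb)
  have hconn := htrav _ hS ⟨v, Or.inl rfl⟩
  obtain ⟨w⟩ := hconn.preconnected ⟨v, Or.inl rfl⟩ ⟨m, Or.inr (hm v hv)⟩
  cases w with
  | nil => exact absurd rfl hv
  | @cons _ u _ h _ =>
    have hadj : G.Adj v u := h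
    exact ⟨u, hadj, u.2.resolve_left hadj.ne'⟩

/-- Iterating a decreasing neighbor function yields a path to the least vertex. -/
theorem exists_isPath_of_adj_prec {V : Type*} {G : SimpleGraph V} {r : V → V → Prop}
    [IsWellOrder V r] {m : V} {p : V → V} (hadj : ∀ v, v ≠ m → G.Adj v (p v))
    (hlt : ∀ v, v ≠ m → r (p v) v) (v : V) :
    ∃ q : G.Walk v m, q.IsPath ∧ ∀ u ∈ q.support, u = v ∨ r u v := by
  induction v using (IsWellFounded.wf (r := r)).induction with
  | _ v ih =>
    by_cases hv : v = m
    · subst hv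
      exact ⟨.nil, by simp, by simp⟩
    · obtain ⟨q, hq, hs⟩ := ih _ (hlt v hv)
      have hs' : ∀ u ∈ q.support, r u v := fun u hu => by
        rcases hs u hu with rfl | h
        · exact hlt v hv
        · exact _root_.trans h (hlt v hv)
      refine ⟨.cons (hadj v hv) q, hq.cons fun h => irrefl v (hs' v h), fun u hu => ?_⟩
      rw [SimpleGraph.Walk.support_cons, List.mem_cons] at hu
      exact hu.imp_right (hs' u)

theorem SimpleGraph.IsAcyclic.dist_eq_dist_add_one_of_adj_prec {V : Type*} {G : SimpleGraph V}
    (hacyc : G.IsAcyclic) {r : V → V → Prop} [IsWellOrder V r] {m : V} {p : V → V}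
    (hadj : ∀ v, v ≠ m → G.Adj v (p v)) (hlt : ∀ v, v ≠ m → r (p v) v) {v : V} (hv : v ≠ m) :
    G.dist m v = G.dist m (p v) + 1 := by
  obtain ⟨q, hq, hs⟩ := exists_isPath_of_adj_prec hadj hlt (p v)
  have hvq : v ∉ q.support := fun h => by
    rcases hs v h with h | h
    · exact (hadj v hv).ne h
    · exact asymm h (hlt v hv)
  rw [G.dist_comm, G.dist_comm (u := m), hacyc.dist_eq_length_of_isPath hq,
    hacyc.dist_eq_length_of_isPath (hq.cons (h := hadj v hv) hvq),
    SimpleGraph.Walk.length_cons]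

/-- Level decomposition of breadth-first traversals of trees.  Let `prec` be a
well-ordered breadth-first traversal (i.e. its least neighbor function `p` is weakly
monotone) of a connected acyclic graph `G`, starting at `v₀`, and let
`L n = {v | dist v₀ v = n}`.  Then `p` maps `L (n+1)` into `L n`, each `L n` is an
interval of `prec`, and `L n` precedes `L (n+1)`. -/
theorem bft_level_decomposition
    {V : Type*} (G : SimpleGraph V) (hG : G.Connected) (hacyc : G.IsAcyclic)
    (prec : V → V → Prop) (hprec : IsWellOrder V prec)
    (htrav : IsTraversal G prec)
    (v₀ : V) (hleast : IsLeastElem prec v₀)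
    (p : V → V) (hp : ∀ v : V, v ≠ v₀ → IsLeastNeighbor G prec v (p v))
    (hbf : ∀ u v : V, u ≠ v₀ → v ≠ v₀ → prec u v → (p u = p v ∨ prec (p u) (p v)))
    (n : ℕ) :
    (∀ v : V, G.dist v₀ v = n + 1 → G.dist v₀ (p v) = n) ∧
    (∀ a b c : V, G.dist v₀ a = n → G.dist v₀ c = n →
      (prec a b ∨ a = b) → (prec b c ∨ b = c) → G.dist v₀ b = n) ∧
    (∀ a b : V, G.dist v₀ a = n → G.dist v₀ b = n + 1 → prec a b) := by
  have hlt : ∀ v, v ≠ v₀ → prec (p v) v := fun v hv => by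
    obtain ⟨u, hu, huv⟩ := htrav.exists_adj_prec hleast hv
    rcases trichotomous_of prec (p v) u with h | h | h
    · exact _root_.trans h huv
    · exact h ▸ huv
    · exact absurd h ((hp v hv).2 u hu)
  have hdist : ∀ v, v ≠ v₀ → G.dist v₀ v = G.dist v₀ (p v) + 1 := fun v hv =>
    hacyc.dist_eq_dist_add_one_of_adj_prec (fun v hv => (hp v hv).1) hlt hv
  have hne : ∀ v, 0 < G.dist v₀ v → v ≠ v₀ := by
    rintro v h rfl
    simp at h
  have hmono : ∀ k a b, G.dist v₀ a = k → k < G.dist v₀ b → prec a b := by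
    intro k
    induction k with
    | zero =>
      intro a b ha hb
      obtain rfl := hG.dist_eq_zero_iff.mp ha
      exact hleast b (hne b hb)
    | succ k ih =>
      intro a b ha hb
      have ha₀ := hne a (by omega)
      have hb₀ := hne b (by omega)
      have hda := hdist a ha₀
      have hdb := hdist b hb₀
      have hpab := ih (p a) (p b) (by omega) (by omega)
      rcases trichotomous_of prec a b with h | h | h
      · exact h
      · subst h
        omega
      · rcases hbf b a hb₀ ha₀ h with h | h
        · exact absurd (h ▸ hpab) (irrefl _)
        · exact absurd h (asymm hpab)
  refine ⟨fun v hv => ?_, fun a b c ha hc hab hbc => ?_, fun a b ha hb => hmono n a b ha (by omega)⟩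
  · have := hdist v (hne v (by omega))
    omega
  · rcases lt_trichotomy (G.dist v₀ b) n with h | h | h
    · have hba := hmono _ b a rfl (ha ▸ h)
      rcases hab with hab | rfl
      · exact absurd hab (asymm hba)
      · exact absurd hba (irrefl _)
    · exact h
    · have hcb := hmono n c b hc h
      rcases hbc with hbc | rfl
      · exact absurd hbc (asymm hcb)
      · exact absurd hcb (irrefl _)
end

section
/- Let (V,E) be a connected simple graph equipped with a well-order < of order type α. Then (V,E) admits a well-ordered breadth-first traversal of order type at most α^ω (ordinal exponentiation). In particular, every connected simple graph equipped with a well-order of its vertices admits a well-ordered breadth-first traversal. -/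
/-- A traversal `prec` is breadth-first if its least neighbor function is weakly
monotone on vertices other than the `prec`-least one. -/
def IsBreadthFirst {V : Type*} (G : SimpleGraph V) (prec : V → V → Prop) : Prop :=
  ∀ u v pu pv : V, (∃ z, prec z u) → (∃ z, prec z v) →
    IsLeastNeighbor G prec u pu → IsLeastNeighbor G prec v pv →
    prec u v → (pu = pv ∨ prec pu pv)

namespace Ordinal

theorem mul_add_lt_mul_of_lt {α a b r : Ordinal} (hr : r < α) (hab : a < b) :
    α * a + r < α * b :=
  calc α * a + r < α * a + α := by gcongr
    _ = α * Order.succ a := (mul_succ α a).symm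
    _ ≤ α * b := by gcongr; exact Order.succ_le_of_lt hab

theorem type_le_of_strictMono {V : Type*} {r : V → V → Prop} [IsWellOrder V r]
    {c : V → Ordinal} {β : Ordinal} (hc : ∀ u v, r u v → c u < c v) (hβ : ∀ v, c v < β) :
    type r ≤ β := by
  let f : V → β.ToType := fun v => ToType.mk ⟨c v, hβ v⟩
  have hf : ∀ u v, r u v → f u < f v := fun u v huv =>
    ToType.mk.lt_iff_lt.2 (hc u v huv)
  simpa using (RelEmbedding.ofMonotone (s := (· < ·)) f hf).ordinal_type_le

end Ordinal

namespace SimpleGraph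

theorem Connected.exists_adj_dist_add_one {V : Type*} {G : SimpleGraph V} (hG : G.Connected)
    {v₀ v : V} {n : ℕ} (hv : G.dist v₀ v = n + 1) : ∃ u, G.Adj v u ∧ G.dist v₀ u = n := by
  obtain ⟨p, hp⟩ := hG.exists_walk_length_eq_dist v v₀
  rw [dist_comm, hv] at hp
  cases p with
  | nil => simp at hp
  | @cons _ u _ huv q =>
    refine ⟨u, huv, ?_⟩
    have h1 : G.dist u v₀ ≤ n := (dist_le q).trans (by simpa using hp.le)
    have h2 := hG.dist_triangle (u := v₀) (v := u) (w := v)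
    have h3 := dist_eq_one_iff_adj.2 huv.symm
    rw [dist_comm] at h1
    omega

/-- The code, in base `α` with digits `d`, of a vertex `v` at distance `n` from `v₀`. It encodes
the least path from `v₀` to `v` of length `n`. -/
noncomputable def levelCode {V : Type*} (G : SimpleGraph V) (v₀ : V) (α : Ordinal)
    (d : V → Ordinal) : ℕ → V → Ordinal
  | 0, _ => 1
  | n + 1, v => α * sInf (levelCode G v₀ α d n '' {u | G.Adj v u ∧ G.dist v₀ u = n}) + d v

/-- The code, in base `α` with digits `d`, of the least geodesic from `v₀` to `v`. -/
noncomputable def geodesicCode {V : Type*} (G : SimpleGraph V) (v₀ : V) (α : Ordinal)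
    (d : V → Ordinal) (v : V) : Ordinal :=
  levelCode G v₀ α d (G.dist v₀ v) v

section geodesicCode

variable {V : Type*} {G : SimpleGraph V} {v₀ : V} {α : Ordinal} {d : V → Ordinal}

theorem geodesicCode_self : geodesicCode G v₀ α d v₀ = 1 := by
  simp [geodesicCode, levelCode]

theorem exists_geodesicCode_eq (hG : G.Connected) {v : V} {n : ℕ} (hv : G.dist v₀ v = n + 1) :
    ∃ u, G.Adj v u ∧ G.dist v₀ u = n ∧
      geodesicCode G v₀ α d v = α * geodesicCode G v₀ α d u + d v ∧
      ∀ w, G.Adj v w → G.dist v₀ w = n → geodesicCode G v₀ α d u ≤ geodesicCode G v₀ α d w := by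
  obtain ⟨x, hx⟩ := hG.exists_adj_dist_add_one hv
  have hne : (levelCode G v₀ α d n '' {u | G.Adj v u ∧ G.dist v₀ u = n}).Nonempty :=
    ⟨_, x, hx, rfl⟩
  obtain ⟨u, ⟨hvu, hu⟩, hcu⟩ := csInf_mem hne
  refine ⟨u, hvu, hu, ?_, fun w hvw hw => ?_⟩
  · rw [geodesicCode, hv, levelCode, geodesicCode, hu, hcu]
  · rw [geodesicCode, geodesicCode, hu, hw, hcu]
    exact csInf_le' ⟨w, ⟨hvw, hw⟩, rfl⟩

theorem geodesicCode_bounds (hG : G.Connected) (hd : ∀ v, d v < α) (v : V) :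
    α ^ G.dist v₀ v ≤ geodesicCode G v₀ α d v ∧
      geodesicCode G v₀ α d v < α ^ G.dist v₀ v * 2 := by
  induction h : G.dist v₀ v generalizing v with
  | zero => simp [geodesicCode, h, levelCode]
  | succ n ih =>
    obtain ⟨u, -, hu, hv, -⟩ := exists_geodesicCode_eq (α := α) (d := d) hG h
    obtain ⟨h1, h2⟩ := ih u hu
    rw [hv, pow_succ', mul_assoc]
    exact ⟨le_add_of_le_left (by gcongr), Ordinal.mul_add_lt_mul_of_lt (hd v) h2⟩

theorem geodesicCode_lt_pow (hG : G.Connected) (hα : 2 ≤ α) (hd : ∀ v, d v < α) (v : V) :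
    geodesicCode G v₀ α d v < α ^ (G.dist v₀ v + 1) := by
  refine (geodesicCode_bounds hG hd v).2.trans_le ?_
  rw [pow_succ]
  gcongr

theorem geodesicCode_lt_of_dist_lt (hG : G.Connected) (hα : 2 ≤ α) (hd : ∀ v, d v < α)
    {u v : V} (h : G.dist v₀ u < G.dist v₀ v) :
    geodesicCode G v₀ α d u < geodesicCode G v₀ α d v :=
  calc geodesicCode G v₀ α d u < α ^ (G.dist v₀ u + 1) := geodesicCode_lt_pow hG hα hd u
    _ ≤ α ^ G.dist v₀ v := by
      gcongr
      · exact one_le_two.trans hα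
      · exact h
    _ ≤ geodesicCode G v₀ α d v := (geodesicCode_bounds hG hd v).1

theorem geodesicCode_injective (hG : G.Connected) (hα : 2 ≤ α) (hd : ∀ v, d v < α)
    (hinj : Function.Injective d) : Function.Injective (geodesicCode G v₀ α d) := by
  intro u v huv
  have hdist : G.dist v₀ u = G.dist v₀ v := by
    rcases lt_trichotomy (G.dist v₀ u) (G.dist v₀ v) with h | h | h
    · exact absurd huv (geodesicCode_lt_of_dist_lt hG hα hd h).ne
    · exact h
    · exact absurd huv (geodesicCode_lt_of_dist_lt hG hα hd h).ne'
  cases hv : G.dist v₀ v with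
  | zero =>
    rw [hv] at hdist
    exact (hG.dist_eq_zero_iff.1 hdist).symm.trans (hG.dist_eq_zero_iff.1 hv)
  | succ n =>
    obtain ⟨a, -, -, ha, -⟩ := exists_geodesicCode_eq (α := α) (d := d) hG (hdist.trans hv)
    obtain ⟨b, -, -, hb, -⟩ := exists_geodesicCode_eq (α := α) (d := d) hG hv
    rw [ha, hb] at huv
    have := congrArg (· % α) huv
    simp only [Ordinal.mul_add_mod_self, Ordinal.mod_eq_of_lt (hd _)] at this
    exact hinj this

theorem exists_parent (hG : G.Connected) (hα : 2 ≤ α) (hd : ∀ v, d v < α) {v : V}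
    (hv : v ≠ v₀) :
    ∃ u, G.Adj v u ∧ geodesicCode G v₀ α d u < geodesicCode G v₀ α d v ∧
      geodesicCode G v₀ α d v = α * geodesicCode G v₀ α d u + d v ∧
      ∀ w, G.Adj v w → geodesicCode G v₀ α d u ≤ geodesicCode G v₀ α d w := by
  obtain ⟨n, hn⟩ := Nat.exists_eq_add_one_of_ne_zero (hG.pos_dist_of_ne hv.symm).ne'
  obtain ⟨u, hvu, hu, hc, hmin⟩ := exists_geodesicCode_eq (α := α) (d := d) hG hn
  refine ⟨u, hvu, geodesicCode_lt_of_dist_lt hG hα hd (by omega), hc, fun w hvw => ?_⟩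
  have h := hG.dist_triangle (u := v₀) (v := w) (w := v)
  rw [dist_eq_one_iff_adj.2 hvw.symm, hn] at h
  rcases (show n ≤ G.dist v₀ w by omega).eq_or_lt with h | h
  · exact hmin w hvw h.symm
  · exact (geodesicCode_lt_of_dist_lt hG hα hd (by omega)).le

end geodesicCode

end SimpleGraph

theorem isTraversal_of_exists_adj {V : Type*} {G : SimpleGraph V} {r : V → V → Prop}
    (hr : WellFounded r) {v₀ : V} (h₀ : IsLeastElem r v₀)
    (h : ∀ v, v ≠ v₀ → ∃ u, G.Adj v u ∧ r u v) : IsTraversal G r := by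
  rintro S hS ⟨x, hx⟩
  have hv₀ : v₀ ∈ S := by
    by_cases hx₀ : x = v₀
    · exact hx₀ ▸ hx
    · exact hS (h₀ x hx₀) hx
  refine (SimpleGraph.connected_iff_exists_forall_reachable _).2 ⟨⟨v₀, hv₀⟩, ?_⟩
  rintro ⟨v, hv⟩
  induction v using hr.induction with
  | h v ih =>
    by_cases hvv : v = v₀
    · subst hvv
      rfl
    · obtain ⟨u, hvu, huv⟩ := h v hvv
      have hadj : (G.induce S).Adj ⟨u, hS huv hv⟩ ⟨v, hv⟩ := hvu.symm
      exact (ih u huv (hS huv hv)).trans hadj.reachable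

/-- Every connected graph equipped with a well-order of order type `α` admits a
well-ordered breadth-first traversal of order type at most `α^ω`. -/
theorem exists_bft_of_type_le
    {V : Type*} (G : SimpleGraph V) (hG : G.Connected)
    (lt : V → V → Prop) (hlt : IsWellOrder V lt) :
    ∃ (prec : V → V → Prop) (hwo : IsWellOrder V prec),
      IsTraversal G prec ∧ IsBreadthFirst G prec ∧
      @Ordinal.type V prec hwo ≤ (@Ordinal.type V lt hlt) ^ Ordinal.omega0 := by
  rcases subsingleton_or_nontrivial V with hV | hV
  · refine ⟨lt, hlt, fun S _ hS => ?_, fun _ _ _ _ _ _ _ _ _ => Or.inl (Subsingleton.elim _ _),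
      Ordinal.left_le_opow _ Ordinal.omega0_pos⟩
    have := hS.to_subtype
    exact SimpleGraph.Connected.of_subsingleton
  obtain ⟨v₀⟩ := hG.nonempty
  set α := Ordinal.type lt
  have hα : 2 ≤ α := by
    obtain ⟨x, y, hxy⟩ : ∃ x y, lt x y := by
      obtain ⟨x, y, hxy⟩ := exists_pair_ne V
      rcases trichotomous_of lt x y with h | h | h
      · exact ⟨x, y, h⟩
      · exact absurd h hxy
      · exact ⟨y, x, h⟩
    rw [← one_add_one_eq_two, ← Order.succ_eq_add_one, Order.succ_le_iff]
    refine lt_of_le_of_lt ?_ (Ordinal.typein_lt_type lt y)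
    rw [Order.one_le_iff_pos]
    exact zero_le.trans_lt ((Ordinal.typein_lt_typein lt).2 hxy)
  let d : V → Ordinal := fun v => Ordinal.typein lt v
  have hd : ∀ v, d v < α := Ordinal.typein_lt_type lt
  let c := G.geodesicCode v₀ α d
  have hinj : Function.Injective c :=
    SimpleGraph.geodesicCode_injective hG hα hd (Ordinal.typein_injective lt)
  have hparent := fun v (hv : v ≠ v₀) => SimpleGraph.exists_parent hG hα hd hv
  have hleast : ∀ v, v ≠ v₀ → c v₀ < c v := fun v hv =>
    SimpleGraph.geodesicCode_lt_of_dist_lt hG hα hd (by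
      simpa using hG.pos_dist_of_ne hv.symm)
  have hwo : IsWellOrder V (fun u v => c u < c v) :=
    (RelEmbedding.preimage ⟨c, hinj⟩ (· < ·)).isWellOrder
  refine ⟨fun u v => c u < c v, hwo, ?_, ?_, ?_⟩
  · refine isTraversal_of_exists_adj hwo.wf hleast fun v hv => ?_
    obtain ⟨u, hvu, huv, -⟩ := hparent v hv
    exact ⟨u, hvu, huv⟩
  · have hcode : ∀ v p, (∃ z, c z < c v) → IsLeastNeighbor G (fun u v => c u < c v) v p →
        c v = α * c p + d v := by
      rintro v p ⟨z, hz⟩ ⟨hvp, hp⟩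
      have hv : v ≠ v₀ := by
        rintro rfl
        by_cases h : z = v
        · exact hz.ne (congrArg c h)
        · exact hz.asymm (hleast z h)
      obtain ⟨u, hvu, -, hcv, hmin⟩ := hparent v hv
      have hup : c u = c p := (hmin p hvp).antisymm (not_lt.1 (hp u hvu))
      exact hcv.trans (by rw [← hup])
    intro u v pu pv hu hv hpu hpv huv
    by_contra! hcon
    have hpp : c pv < c pu := lt_of_le_of_ne hcon.2 (hinj.ne hcon.1.symm)
    refine huv.asymm ?_
    rw [hcode u pu hu hpu, hcode v pv hv hpv]
    exact (Ordinal.mul_add_lt_mul_of_lt (hd v) hpp).trans_le le_self_add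
  · refine Ordinal.type_le_of_strictMono (c := c) (fun _ _ h => h) fun v => ?_
    refine (SimpleGraph.geodesicCode_lt_pow hG hα hd v).trans_le ?_
    rw [← Ordinal.opow_natCast]
    exact Ordinal.opow_le_opow_right (zero_lt_two.trans_le hα) (Ordinal.natCast_lt_omega0 _).le
end
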